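/- Fix λ₁, λ₂ ∈ ℂ with λ₁·λ₂·(λ₁−λ₂) ≠ 0. For each of the four pairs (A,B) with A ∈ {Φ_{λ₁}, W^r_{λ₁}} and B ∈ {Φ_{λ₂}, W^r_{λ₂}}, the function F⁺_{A,B} on V defined by F⁺_{A,B}(Y,Z) = (A(ν₁)·B(ν₂) + A(ν₂)·B(ν₁))/|ν₁ − ν₂| when S₀ > 0 and S ≠ 0, and by 0 otherwise, is locally integrable on the open set 𝒰 with respect to Lebesgue measure. -/

import Mathlib

open MeasureTheory

/-- The entire function `Φ_λ(z) = Σ_{n≥0} (λz)ⁿ/(4ⁿ (n!)²)`. -/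
noncomputable def Phi (lam z : ℂ) : ℂ :=
  ∑' n : ℕ, (lam * z) ^ n / (4 ^ n * (n.factorial : ℂ) ^ 2)

/-- `a(n) = −2 Γ′(n+1)/Γ(n+1)` where `Γ` is the real Gamma function. -/
noncomputable def aCoef (n : ℕ) : ℝ :=
  -2 * deriv Real.Gamma ((n : ℝ) + 1) / Real.Gamma ((n : ℝ) + 1)

/-- The entire function `w_λ(z) = Σ_{n≥0} a(n) (λz)ⁿ/(4ⁿ (n!)²)`. -/
noncomputable def wFun (lam z : ℂ) : ℂ :=
  ∑' n : ℕ, (aCoef n : ℂ) * (lam * z) ^ n / (4 ^ n * (n.factorial : ℂ) ^ 2)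

/-- `W^r_λ(t) = w_λ(t) + log|t| Φ_λ(t)` for real `t`. -/
noncomputable def Wr (lam : ℂ) (t : ℝ) : ℂ :=
  wFun lam t + (Real.log |t| : ℂ) * Phi lam t

/-- The space `V = M₂(ℝ) × M₂(ℝ)` of pairs of 2×2 real matrices. -/
abbrev V : Type := (Fin 2 → Fin 2 → ℝ) × (Fin 2 → Fin 2 → ℝ)

/-- `Q = tr(YZ)`. -/
noncomputable def Qf (p : V) : ℝ := (Matrix.of p.1 * Matrix.of p.2).trace

/-- `S = det Y · det Z`. -/
noncomputable def Sf (p : V) : ℝ := (Matrix.of p.1).det * (Matrix.of p.2).det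

/-- `S₀ = Q² − 4S`. -/
noncomputable def S0f (p : V) : ℝ := Qf p ^ 2 - 4 * Sf p

/-- `ν₁ = (Q + √S₀)/2` (real, used when `S₀ > 0`). -/
noncomputable def nu1r (p : V) : ℝ := (Qf p + Real.sqrt (S0f p)) / 2

/-- `ν₂ = (Q − √S₀)/2` (real, used when `S₀ > 0`). -/
noncomputable def nu2r (p : V) : ℝ := (Qf p - Real.sqrt (S0f p)) / 2

/-- The open set `𝒰`, complement of the nilpotent cone: `(Q,S) ≠ (0,0)`. -/
def U : Set V := {p | ¬(Qf p = 0 ∧ Sf p = 0)}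

/-- The weight `|t|^{-1/2}`, with value `∞` at `0`. -/
noncomputable def invSqrtWeight (t : ℝ) : ENNReal := (ENNReal.ofReal (Real.sqrt |t|))⁻¹

@[fun_prop]
theorem measurable_invSqrtWeight : Measurable invSqrtWeight := by
  unfold invSqrtWeight
  fun_prop

theorem invSqrtWeight_mul (a b : ℝ) :
    invSqrtWeight (a * b) = invSqrtWeight a * invSqrtWeight b := by
  unfold invSqrtWeight
  rw [abs_mul, Real.sqrt_mul (abs_nonneg a), ENNReal.ofReal_mul (Real.sqrt_nonneg _),
    ENNReal.mul_inv (Or.inr ENNReal.ofReal_ne_top) (Or.inl ENNReal.ofReal_ne_top)]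

theorem invSqrtWeight_neg (t : ℝ) : invSqrtWeight (-t) = invSqrtWeight t := by
  simp [invSqrtWeight]

theorem setLIntegral_invSqrtWeight_Ioc_lt_top :
    ∫⁻ x in Set.Ioc (0 : ℝ) 1, invSqrtWeight x < ⊤ := by
  have h := (intervalIntegral.intervalIntegrable_rpow' (a := 0) (b := 1)
    (r := -(1 / 2)) (by norm_num))
  rw [intervalIntegrable_iff_integrableOn_Ioc_of_le zero_le_one] at h
  refine lt_of_eq_of_lt (setLIntegral_congr_fun measurableSet_Ioc fun x hx => ?_) h.2
  have hx0 : 0 < x := hx.1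
  beta_reduce
  rw [Real.enorm_of_nonneg (by positivity), Real.rpow_neg hx0.le, ← Real.sqrt_eq_rpow,
    ENNReal.ofReal_inv_of_pos (by positivity), invSqrtWeight, abs_of_pos hx0]

theorem setLIntegral_invSqrtWeight_Icc_lt_top :
    ∫⁻ x in Set.Icc (-1 : ℝ) 1, invSqrtWeight x < ⊤ := by
  have hneg : ∫⁻ x in Set.Ico (-1 : ℝ) 0, invSqrtWeight x < ⊤ := by
    have h := (Measure.measurePreserving_neg (volume : Measure ℝ)).setLIntegral_comp_preimage
      (measurableSet_Ioc (a := (0 : ℝ)) (b := 1)) measurable_invSqrtWeight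
    simp only [invSqrtWeight_neg] at h
    have hs : (Neg.neg ⁻¹' Set.Ioc (0 : ℝ) 1) = Set.Ico (-1 : ℝ) 0 := by
      simp
    rw [hs] at h
    exact h ▸ setLIntegral_invSqrtWeight_Ioc_lt_top
  have hcover : Set.Icc (-1 : ℝ) 1 ⊆ (Set.Ico (-1 : ℝ) 0 ∪ Set.Ioc (0 : ℝ) 1) ∪ {0} := by
    intro x hx
    rcases lt_trichotomy x 0 with h | h | h
    · exact Or.inl (Or.inl ⟨hx.1, h⟩)
    · exact Or.inr h
    · exact Or.inl (Or.inr ⟨h, hx.2⟩)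
  refine (lintegral_mono_set hcover).trans_lt ((lintegral_union_le _ _ _).trans_lt ?_)
  rw [show ∫⁻ x in ({0} : Set ℝ), invSqrtWeight x = 0 from
    setLIntegral_measure_zero _ _ (by simp), add_zero]
  exact (lintegral_union_le _ _ _).trans_lt
    (ENNReal.add_lt_top.2 ⟨hneg, setLIntegral_invSqrtWeight_Ioc_lt_top⟩)

/-- `|x - c|^{-1/2}` has integral over a bounded set bounded uniformly in `c`. -/
theorem exists_setLIntegral_invSqrtWeight_add_le {s : Set ℝ} (hs : volume s ≠ ⊤) :
    ∃ C : ENNReal, C ≠ ⊤ ∧ C ≠ 0 ∧ ∀ c : ℝ, ∫⁻ x in s, invSqrtWeight (x + c) ≤ C := by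
  refine ⟨(∫⁻ x in Set.Icc (-1 : ℝ) 1, invSqrtWeight x) + (1 + volume s), ?_, by simp, fun c => ?_⟩
  · exact (ENNReal.add_lt_top.2 ⟨setLIntegral_invSqrtWeight_Icc_lt_top,
      ENNReal.add_lt_top.2 ⟨ENNReal.one_lt_top, hs.lt_top⟩⟩).ne
  have hle : ∀ y, invSqrtWeight y ≤ (Set.Icc (-1 : ℝ) 1).indicator invSqrtWeight y + 1 := by
    intro y
    by_cases hy : y ∈ Set.Icc (-1 : ℝ) 1
    · simp [hy]
    · have : 1 ≤ |y| := by
        by_contra! h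
        exact hy (abs_le.1 h.le)
      simp only [hy, not_false_eq_true, Set.indicator_of_notMem, zero_add]
      rw [invSqrtWeight, ENNReal.inv_le_one, ENNReal.one_le_ofReal]
      exact Real.one_le_sqrt.2 this
  calc ∫⁻ x in s, invSqrtWeight (x + c)
      ≤ ∫⁻ x in s, ((Set.Icc (-1 : ℝ) 1).indicator invSqrtWeight (x + c) + 1) :=
        lintegral_mono fun x => hle _
    _ = (∫⁻ x in s, (Set.Icc (-1 : ℝ) 1).indicator invSqrtWeight (x + c)) + volume s := by
        rw [lintegral_add_right _ measurable_const]
        simp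
    _ ≤ (∫⁻ x, (Set.Icc (-1 : ℝ) 1).indicator invSqrtWeight (x + c)) + (1 + volume s) := by
        gcongr
        · exact Measure.restrict_le_self
        · exact le_add_self
    _ = _ := by
        rw [lintegral_add_right_eq_self, lintegral_indicator measurableSet_Icc]

theorem exists_setLIntegral_invSqrtWeight_affine_le {s : Set ℝ} (hs : volume s ≠ ⊤) :
    ∃ C : ENNReal, C ≠ ⊤ ∧ ∀ u c : ℝ,
      ∫⁻ x in s, invSqrtWeight (x * u + c) ≤ C * invSqrtWeight u := by
  obtain ⟨C, hC, hC0, h⟩ := exists_setLIntegral_invSqrtWeight_add_le hs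
  refine ⟨C, hC, fun u c => ?_⟩
  rcases eq_or_ne u 0 with rfl | hu
  · simp [invSqrtWeight, ENNReal.mul_top hC0]
  have : ∀ x, invSqrtWeight (x * u + c) = invSqrtWeight (x + c / u) * invSqrtWeight u := by
    intro x
    rw [← invSqrtWeight_mul]
    congr 1
    field_simp
  simp only [this]
  rw [lintegral_mul_const _ (by fun_prop)]
  gcongr
  exact h _

theorem measurePreserving_matrixTwo_entries :
    MeasurePreserving (fun m : Fin 2 → Fin 2 → ℝ => ((m 0 0, m 0 1), (m 1 0, m 1 1))) :=
  ((volume_preserving_finTwoArrow ℝ).prod (volume_preserving_finTwoArrow ℝ)).comp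
    (volume_preserving_finTwoArrow (Fin 2 → ℝ))

theorem setLIntegral_invSqrtWeight_antidiagonal_lt_top (R : ℝ) {v : ℝ → ℝ → ℝ}
    (hv : Measurable (Function.uncurry v)) :
    ∫⁻ m in Metric.closedBall (0 : Fin 2 → Fin 2 → ℝ) R,
      invSqrtWeight (m 0 1 * m 1 0 + v (m 0 0) (m 1 1)) < ⊤ := by
  set I : Set ℝ := Set.Icc (-R) R
  have hI : volume I ≠ ⊤ := by simp [I]
  have hIm : MeasurableSet I := measurableSet_Icc
  obtain ⟨C, hC, hCle⟩ := exists_setLIntegral_invSqrtWeight_affine_le hI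
  have hv' : ∀ {α : Type} [MeasurableSpace α] {f g : α → ℝ}, Measurable f → Measurable g →
      Measurable fun x => v (f x) (g x) := fun hf hg => hv.comp (hf.prodMk hg)
  have hf : Measurable fun q : (ℝ × ℝ) × (ℝ × ℝ) =>
      invSqrtWeight (q.1.2 * q.2.1 + v q.1.1 q.2.2) :=
    measurable_invSqrtWeight.comp
      ((by fun_prop : Measurable fun q : (ℝ × ℝ) × (ℝ × ℝ) => q.1.2 * q.2.1).add
        (hv' (by fun_prop) (by fun_prop)))
  have hsub : Metric.closedBall (0 : Fin 2 → Fin 2 → ℝ) R ⊆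
      (fun m : Fin 2 → Fin 2 → ℝ => ((m 0 0, m 0 1), (m 1 0, m 1 1))) ⁻¹'
        ((I ×ˢ I) ×ˢ (I ×ˢ I)) := by
    intro m hm
    have hm' : ‖m‖ ≤ R := by simpa using hm
    have h : ∀ i j, m i j ∈ I := fun i j =>
      abs_le.1 (((norm_le_pi_norm (m i) j).trans (norm_le_pi_norm m i)).trans hm')
    exact ⟨⟨h _ _, h _ _⟩, ⟨h _ _, h _ _⟩⟩
  refine (lintegral_mono_set hsub).trans_lt ?_
  rw [measurePreserving_matrixTwo_entries.setLIntegral_comp_preimage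
    ((hIm.prod hIm).prod (hIm.prod hIm)) hf, Measure.volume_eq_prod, ← Measure.prod_restrict,
    lintegral_prod_symm _ hf.aemeasurable]
  have hinner : ∀ q : ℝ × ℝ, ∫⁻ r in I ×ˢ I, invSqrtWeight (r.2 * q.1 + v r.1 q.2) ≤
      C * invSqrtWeight q.1 * volume I := by
    intro q
    rw [Measure.volume_eq_prod, ← Measure.prod_restrict]
    refine (lintegral_prod_le _).trans ?_
    refine (lintegral_mono fun a => hCle q.1 (v a q.2)).trans ?_
    simp
  refine (lintegral_mono hinner).trans_lt ?_
  rw [lintegral_mul_const _ (by fun_prop), lintegral_const_mul _ (by fun_prop),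
    Measure.volume_eq_prod, ← Measure.prod_restrict]
  refine ENNReal.mul_lt_top (ENNReal.mul_lt_top hC.lt_top ?_) hI.lt_top
  refine (lintegral_prod_le _).trans_lt ?_
  simp only [lintegral_const, Measure.restrict_apply_univ]
  rw [lintegral_mul_const _ (by fun_prop)]
  refine ENNReal.mul_lt_top ?_ hI.lt_top
  have h1 := hCle 1 0
  simp only [mul_one, add_zero] at h1
  refine h1.trans_lt (ENNReal.mul_lt_top hC.lt_top ?_)
  simp [invSqrtWeight]

theorem continuous_tsum_mul_pow_of_norm_le {c : ℕ → ℂ} {K : ℝ}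
    (hc : ∀ n, ‖c n‖ ≤ K / n.factorial) : Continuous fun z : ℂ => ∑' n, c n * z ^ n := by
  refine continuous_iff_continuousAt.2 fun z₀ => ?_
  have hcont : ContinuousOn (fun z : ℂ => ∑' n, c n * z ^ n) (Metric.closedBall 0 (‖z₀‖ + 1)) := by
    have hsum := (Real.summable_pow_div_factorial (‖z₀‖ + 1)).mul_left K
    refine continuousOn_tsum (fun n => by fun_prop) hsum fun n z hz => ?_
    have hz' : ‖z‖ ≤ ‖z₀‖ + 1 := by simpa using hz
    rw [norm_mul, norm_pow]
    calc ‖c n‖ * ‖z‖ ^ n ≤ K / n.factorial * (‖z₀‖ + 1) ^ n := by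
          gcongr
          · exact (norm_nonneg _).trans (hc n)
          · exact hc n
      _ = _ := by ring
  have hz₀ : z₀ ∈ Metric.ball (0 : ℂ) (‖z₀‖ + 1) := by simp
  exact hcont.continuousAt
    (Filter.mem_of_superset (Metric.isOpen_ball.mem_nhds hz₀) Metric.ball_subset_closedBall)

theorem abs_aCoef_le (n : ℕ) : |aCoef n| ≤ 2 * (n + 1) := by
  have hf : (n.factorial : ℝ) ≠ 0 := by positivity
  have h : aCoef n = -2 * (-Real.eulerMascheroniConstant + harmonic n) := by
    rw [aCoef, Real.deriv_Gamma_nat, Real.Gamma_nat_eq_factorial]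
    field_simp
  have h1 := Real.one_half_lt_eulerMascheroniConstant
  have h2 := Real.eulerMascheroniConstant_lt_two_thirds
  have h3 : (0 : ℝ) ≤ harmonic n := by
    exact_mod_cast Finset.sum_nonneg fun i _ => by positivity
  have h4 : (harmonic n : ℝ) ≤ n + 1 := by
    have := harmonic_le_one_add_log n
    have := Real.log_le_self (Nat.cast_nonneg (α := ℝ) n)
    linarith
  rw [h, abs_le]
  constructor <;> linarith

theorem inv_factorial_sq_le (n : ℕ) :
    (1 : ℝ) / (n.factorial : ℝ) ^ 2 ≤ 1 / n.factorial := by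
  have : (1 : ℝ) ≤ n.factorial := by exact_mod_cast n.factorial_pos
  gcongr
  nlinarith

theorem continuous_Phi (lam : ℂ) : Continuous (Phi lam) := by
  have h := continuous_tsum_mul_pow_of_norm_le
    (c := fun n => 1 / (4 ^ n * (n.factorial : ℂ) ^ 2)) (K := 1) fun n => by
      rw [norm_div, norm_mul, norm_pow, norm_pow]
      simp only [norm_one, Complex.norm_natCast, Complex.norm_ofNat]
      refine le_trans ?_ (inv_factorial_sq_le n)
      gcongr
      exact le_mul_of_one_le_left (by positivity) (one_le_pow₀ (by norm_num))
  convert h.comp (continuous_const_mul lam) using 1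
  ext z
  simp only [Phi, Function.comp_apply]
  congr 1 with n
  ring

theorem continuous_wFun (lam : ℂ) : Continuous (wFun lam) := by
  have h := continuous_tsum_mul_pow_of_norm_le
    (c := fun n => aCoef n / (4 ^ n * (n.factorial : ℂ) ^ 2)) (K := 2) fun n => by
      rw [norm_div, norm_mul, norm_pow, norm_pow]
      simp only [Complex.norm_real, Complex.norm_natCast, Complex.norm_ofNat, Real.norm_eq_abs]
      have hn : (n : ℝ) + 1 ≤ 4 ^ n := by
        exact_mod_cast Nat.lt_pow_self (n := n) (a := 4) (by norm_num)
      calc |aCoef n| / (4 ^ n * (n.factorial : ℝ) ^ 2)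
          ≤ 2 * 4 ^ n / (4 ^ n * (n.factorial : ℝ) ^ 2) := by
            gcongr
            exact (abs_aCoef_le n).trans (by gcongr)
        _ = 2 * (1 / (n.factorial : ℝ) ^ 2) := by field_simp
        _ ≤ 2 * (1 / n.factorial) := by have := inv_factorial_sq_le n; gcongr
        _ = _ := by ring
  convert h.comp (continuous_const_mul lam) using 1
  ext z
  simp only [wFun, Function.comp_apply]
  congr 1 with n
  ring

/-- A measurable function on `ℝ` that is locally bounded up to a factor `1 + |log |t||`. -/
def HasLogGrowth (A : ℝ → ℂ) : Prop :=
  Measurable A ∧ ∀ M : ℝ, ∃ C, 0 ≤ C ∧ ∀ t, |t| ≤ M → ‖A t‖ ≤ C * (1 + |Real.log (|t|)|)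

theorem Continuous.exists_norm_le_of_abs_le {f : ℝ → ℂ} (hf : Continuous f) (M : ℝ) :
    ∃ C, 0 ≤ C ∧ ∀ t, |t| ≤ M → ‖f t‖ ≤ C := by
  obtain ⟨C, hC⟩ := (isCompact_Icc (a := -M) (b := M)).exists_bound_of_continuousOn hf.continuousOn
  exact ⟨max C 0, le_max_right _ _, fun t ht => (hC t (abs_le.1 ht)).trans (le_max_left _ _)⟩

theorem hasLogGrowth_Phi (lam : ℂ) : HasLogGrowth fun t : ℝ => Phi lam t := by
  have hc : Continuous fun t : ℝ => Phi lam t := (continuous_Phi lam).comp Complex.continuous_ofReal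
  refine ⟨hc.measurable, fun M => ?_⟩
  obtain ⟨C, hC, h⟩ := hc.exists_norm_le_of_abs_le M
  exact ⟨C, hC, fun t ht => (h t ht).trans (le_mul_of_one_le_right hC (by simp))⟩

theorem hasLogGrowth_Wr (lam : ℂ) : HasLogGrowth (Wr lam) := by
  have hP : Continuous fun t : ℝ => Phi lam t := (continuous_Phi lam).comp Complex.continuous_ofReal
  have hw : Continuous fun t : ℝ => wFun lam t :=
    (continuous_wFun lam).comp Complex.continuous_ofReal
  refine ⟨hw.measurable.add (Measurable.mul (by fun_prop) hP.measurable), fun M => ?_⟩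
  obtain ⟨C, hC, h⟩ := hP.exists_norm_le_of_abs_le M
  obtain ⟨D, hD, h'⟩ := hw.exists_norm_le_of_abs_le M
  refine ⟨C + D, by positivity, fun t ht => ?_⟩
  rw [Wr]
  refine (norm_add_le _ _).trans ?_
  rw [norm_mul, Complex.norm_real, Real.norm_eq_abs]
  have h1 := h t ht
  have h2 := h' t ht
  have h3 := abs_nonneg (Real.log (|t|))
  nlinarith [mul_le_mul_of_nonneg_left h1 h3, mul_nonneg hD h3]

theorem one_add_abs_log_le {M t : ℝ} (ht : t ≠ 0) (hM : |t| ≤ M) :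
    1 + |Real.log (|t|)| ≤ (√M + 2 * M + 2) / √|t| := by
  have ht0 : 0 < |t| := abs_pos.2 ht
  set r := √|t|
  have hr : 0 < r := Real.sqrt_pos.2 ht0
  have hrr : |t| = r ^ 2 := (Real.sq_sqrt ht0.le).symm
  have hrM : r ≤ √M := Real.sqrt_le_sqrt hM
  rw [le_div_iff₀ hr, hrr, Real.log_pow]
  have h1 : Real.log r ≤ r := Real.log_le_self hr.le
  have h2 : -Real.log r ≤ r⁻¹ := by
    rw [← Real.log_inv]
    exact Real.log_le_self (by positivity)
  have h3 : r⁻¹ * r = 1 := inv_mul_cancel₀ hr.ne'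
  have h4 : |Real.log r| ≤ r + r⁻¹ := by
    have := inv_pos.2 hr
    rw [abs_le]
    constructor <;> linarith
  rw [abs_mul]
  push_cast
  rw [abs_of_pos (by norm_num : (0 : ℝ) < 2)]
  have h5 := mul_le_mul_of_nonneg_right h4 hr.le
  nlinarith [hrr ▸ hM]

theorem nu1r_mul_nu2r {p : V} (h : 0 ≤ S0f p) : nu1r p * nu2r p = Sf p := by
  have h1 := Real.sq_sqrt h
  have h2 : S0f p = Qf p ^ 2 - 4 * Sf p := rfl
  unfold nu1r nu2r
  nlinarith

theorem nu1r_sub_nu2r (p : V) : nu1r p - nu2r p = √(S0f p) := by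
  unfold nu1r nu2r
  ring

theorem continuous_Qf : Continuous Qf := by
  have : Qf = fun p : V =>
      p.1 0 0 * p.2 0 0 + p.1 0 1 * p.2 1 0 + (p.1 1 0 * p.2 0 1 + p.1 1 1 * p.2 1 1) := by
    ext p
    simp [Qf, Matrix.trace, Matrix.mul_apply, Fin.sum_univ_two]
  rw [this]
  fun_prop

theorem continuous_matrixTwo_det :
    Continuous fun Y : Fin 2 → Fin 2 → ℝ => (Matrix.of Y).det := by
  simp only [Matrix.det_fin_two, Matrix.of_apply]
  fun_prop

theorem continuous_Sf : Continuous Sf :=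
  (continuous_matrixTwo_det.comp continuous_fst).mul (continuous_matrixTwo_det.comp continuous_snd)

theorem continuous_S0f : Continuous S0f :=
  (continuous_Qf.pow 2).sub (continuous_const.mul continuous_Sf)

theorem continuous_nu1r : Continuous nu1r :=
  (continuous_Qf.add (Real.continuous_sqrt.comp continuous_S0f)).div_const 2

theorem continuous_nu2r : Continuous nu2r :=
  (continuous_Qf.sub (Real.continuous_sqrt.comp continuous_S0f)).div_const 2

/-- Right multiplication `Z ↦ ZY` on `2 × 2` matrices, acting row by row. -/
noncomputable def rightMul (Y : Fin 2 → Fin 2 → ℝ) :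
    (Fin 2 → Fin 2 → ℝ) →ₗ[ℝ] (Fin 2 → Fin 2 → ℝ) :=
  LinearMap.pi fun i => (Matrix.toLin' (Matrix.of Y).transpose).comp (LinearMap.proj i)

theorem rightMul_apply (Y Z : Fin 2 → Fin 2 → ℝ) (i j : Fin 2) :
    rightMul Y Z i j = Y 0 j * Z i 0 + Y 1 j * Z i 1 := by
  simp [rightMul, Matrix.mulVec, dotProduct, Fin.sum_univ_two]

theorem det_rightMul (Y : Fin 2 → Fin 2 → ℝ) :
    LinearMap.det (rightMul Y) = (Matrix.of Y).det ^ 2 := by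
  rw [rightMul, LinearMap.det_pi]
  simp

theorem S0f_div_four (p : V) :
    S0f p / 4 = rightMul p.1 p.2 0 1 * rightMul p.1 p.2 1 0 +
      ((rightMul p.1 p.2 0 0 - rightMul p.1 p.2 1 1) / 2) ^ 2 := by
  simp only [rightMul_apply, S0f, Qf, Sf, Matrix.trace_fin_two, Matrix.det_fin_two,
    Matrix.mul_apply, Fin.sum_univ_two, Matrix.of_apply]
  ring

theorem norm_rightMul_le {Y Z : Fin 2 → Fin 2 → ℝ} {R : ℝ} (hY : ‖Y‖ ≤ R) (hZ : ‖Z‖ ≤ R) :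
    ‖rightMul Y Z‖ ≤ 2 * R ^ 2 := by
  have hR : 0 ≤ R := (norm_nonneg _).trans hY
  have hentry : ∀ {m : Fin 2 → Fin 2 → ℝ}, ‖m‖ ≤ R → ∀ i j, |m i j| ≤ R := fun {m} hm i j =>
    ((norm_le_pi_norm (m i) j).trans (norm_le_pi_norm m i)).trans hm
  refine (pi_norm_le_iff_of_nonneg (by positivity)).2 fun i =>
    (pi_norm_le_iff_of_nonneg (by positivity)).2 fun j => ?_
  rw [rightMul_apply, Real.norm_eq_abs]
  refine (abs_add_le _ _).trans ?_
  rw [abs_mul, abs_mul]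
  have h1 := mul_le_mul (hentry hY 0 j) (hentry hZ i 0) (abs_nonneg _) hR
  have h2 := mul_le_mul (hentry hY 1 j) (hentry hZ i 1) (abs_nonneg _) hR
  linarith

theorem setLIntegral_rightMul_le {Y : Fin 2 → Fin 2 → ℝ} {R ε : ℝ} (hε : 0 < ε) (hY : ‖Y‖ ≤ R)
    (hdet : ε ≤ |(Matrix.of Y).det|) {f : (Fin 2 → Fin 2 → ℝ) → ENNReal} (hf : Measurable f) :
    ∫⁻ Z in Metric.closedBall 0 R, f (rightMul Y Z) ≤
      ENNReal.ofReal (ε ^ 2)⁻¹ * ∫⁻ X in Metric.closedBall 0 (2 * R ^ 2), f X := by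
  have hdet0 : (Matrix.of Y).det ≠ 0 := abs_pos.1 (hε.trans_le hdet)
  have hcont : Measurable (rightMul Y) := (rightMul Y).continuous_of_finiteDimensional.measurable
  have hsub : Metric.closedBall 0 R ⊆ rightMul Y ⁻¹' Metric.closedBall 0 (2 * R ^ 2) := by
    intro Z hZ
    simp only [Set.mem_preimage, mem_closedBall_zero_iff] at hZ ⊢
    exact norm_rightMul_le hY hZ
  refine (lintegral_mono_set hsub).trans ?_
  rw [← setLIntegral_map Metric.isClosed_closedBall.measurableSet hf hcont,
    Measure.map_linearMap_addHaar_eq_smul_addHaar _ (by rw [det_rightMul]; positivity),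
    Measure.restrict_smul, lintegral_smul_measure, smul_eq_mul]
  gcongr
  rw [det_rightMul, abs_inv, abs_pow]
  gcongr

theorem setLIntegral_invSqrtWeight_S0f_lt_top (R : ℝ) {ε : ℝ} (hε : 0 < ε) :
    ∫⁻ p in {Y | ‖Y‖ ≤ R ∧ ε ≤ |(Matrix.of Y).det|} ×ˢ Metric.closedBall 0 R,
      invSqrtWeight (S0f p / 4) < ⊤ := by
  set T : Set (Fin 2 → Fin 2 → ℝ) := {Y | ‖Y‖ ≤ R ∧ ε ≤ |(Matrix.of Y).det|}
  have hT : MeasurableSet T := ((isClosed_le continuous_norm continuous_const).inter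
    (isClosed_le continuous_const continuous_matrixTwo_det.abs)).measurableSet
  have hTfin : volume T < ⊤ := by
    refine (measure_mono fun Y hY => ?_).trans_lt
      (measure_closedBall_lt_top (x := (0 : Fin 2 → Fin 2 → ℝ)) (r := R))
    simpa using hY.1
  have hv : Measurable (Function.uncurry fun a d : ℝ => ((a - d) / 2) ^ 2) := by
    unfold Function.uncurry
    fun_prop
  have hJ := setLIntegral_invSqrtWeight_antidiagonal_lt_top (2 * R ^ 2) hv
  rw [Measure.volume_eq_prod, ← Measure.prod_restrict]
  refine (lintegral_prod_le _).trans_lt ?_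
  refine (setLIntegral_mono' (g := fun _ => ENNReal.ofReal (ε ^ 2)⁻¹ *
    ∫⁻ m in Metric.closedBall (0 : Fin 2 → Fin 2 → ℝ) (2 * R ^ 2),
      invSqrtWeight (m 0 1 * m 1 0 + ((m 0 0 - m 1 1) / 2) ^ 2)) hT fun Y hY => ?_).trans_lt ?_
  · simp only [S0f_div_four]
    exact setLIntegral_rightMul_le hε hY.1 hY.2
      (f := fun X => invSqrtWeight (X 0 1 * X 1 0 + ((X 0 0 - X 1 1) / 2) ^ 2)) (by fun_prop)
  · rw [lintegral_const, Measure.restrict_apply_univ]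
    exact ENNReal.mul_lt_top (ENNReal.mul_lt_top ENNReal.ofReal_lt_top hJ) hTfin

theorem setLIntegral_invSqrtWeight_Sf_lt_top (R : ℝ) :
    ∫⁻ p in Metric.closedBall (0 : V) R, invSqrtWeight (Sf p) < ⊤ := by
  have hv : Measurable (Function.uncurry fun a d : ℝ => -(a * d)) := by
    unfold Function.uncurry
    fun_prop
  have hJ := setLIntegral_invSqrtWeight_antidiagonal_lt_top R hv
  have hdet : ∀ Y : Fin 2 → Fin 2 → ℝ,
      invSqrtWeight (Matrix.of Y).det = invSqrtWeight (Y 0 1 * Y 1 0 + -(Y 0 0 * Y 1 1)) := by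
    intro Y
    rw [← invSqrtWeight_neg, Matrix.det_fin_two]
    congr 1
    simp only [Matrix.of_apply]
    ring
  simp only [← hdet] at hJ
  have hm : Measurable fun Y : Fin 2 → Fin 2 → ℝ => invSqrtWeight (Matrix.of Y).det :=
    measurable_invSqrtWeight.comp continuous_matrixTwo_det.measurable
  simp only [Sf, invSqrtWeight_mul]
  rw [show (0 : V) = (0, 0) from rfl, ← closedBall_prod_same, Measure.volume_eq_prod,
    ← Measure.prod_restrict, lintegral_prod_mul hm.aemeasurable hm.aemeasurable]
  exact ENNReal.mul_lt_top hJ hJ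

theorem integrableOn_of_norm_mul_sqrt_le {f : V → ℂ} {t : V → ℝ} {s : Set V} {C : ℝ}
    (hf : Measurable f) (ht : Measurable t) (hs : MeasurableSet s)
    (hC : ∀ p ∈ s, f p ≠ 0 → t p ≠ 0 ∧ ‖f p‖ * √|t p| ≤ C)
    (hint : ∫⁻ p in s, invSqrtWeight (t p) < ⊤) : IntegrableOn f s := by
  refine ⟨hf.aestronglyMeasurable, ?_⟩
  refine (setLIntegral_mono' (g := fun p => ENNReal.ofReal C * invSqrtWeight (t p)) hs
    fun p hp => ?_).trans_lt ?_
  · rcases eq_or_ne (f p) 0 with h0 | h0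
    · simp [h0]
    obtain ⟨htp, hle⟩ := hC p hp h0
    have hpos : 0 < √|t p| := Real.sqrt_pos.2 (abs_pos.2 htp)
    rw [← ofReal_norm, invSqrtWeight, ← div_eq_mul_inv, ← ENNReal.ofReal_div_of_pos hpos]
    exact ENNReal.ofReal_le_ofReal ((le_div_iff₀ hpos).2 hle)
  · rw [lintegral_const_mul _ (by fun_prop)]
    exact ENNReal.mul_lt_top ENNReal.ofReal_lt_top hint

theorem abs_log_le_of_le {ε M t : ℝ} (hε : 0 < ε) (h : ε ≤ |t|) (hM : |t| ≤ M) :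
    |Real.log (|t|)| ≤ M + ε⁻¹ := by
  have ht : 0 < |t| := hε.trans_le h
  have h1 := Real.log_le_self ht.le
  have h2 : -Real.log (|t|) ≤ |t|⁻¹ := by
    rw [← Real.log_inv]
    exact Real.log_le_self (by positivity)
  have h3 : |t|⁻¹ ≤ ε⁻¹ := by gcongr
  have h4 := inv_pos.2 hε
  rw [abs_le]
  constructor <;> linarith

theorem one_add_abs_log_mul_le {ε M x y : ℝ} (hε : 0 < ε) (hx : ε ≤ |x|) (hM : |x| ≤ M)
    (hy : y ≠ 0) :
    (1 + |Real.log (|x|)|) * (1 + |Real.log (|y|)|) ≤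
      (1 + (M + ε⁻¹)) ^ 2 * (1 + |Real.log (|x * y|)|) := by
  have hx0 : 0 < |x| := hε.trans_le hx
  have h1 := abs_log_le_of_le hε hx hM
  have h2 : |Real.log (|y|)| ≤ |Real.log (|x * y|)| + (M + ε⁻¹) := by
    have : Real.log (|y|) = Real.log (|x * y|) - Real.log (|x|) := by
      rw [abs_mul, Real.log_mul hx0.ne' (abs_pos.2 hy).ne']
      ring
    rw [this]
    exact (abs_sub _ _).trans (by linarith)
  set L := M + ε⁻¹
  have hL : 0 ≤ L := (abs_nonneg _).trans h1
  have h3 := abs_nonneg (Real.log (|x * y|))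
  calc _ ≤ (1 + L) * (1 + (|Real.log (|x * y|)| + L)) := by gcongr
    _ ≤ _ := by nlinarith [mul_nonneg hL h3, mul_nonneg (mul_nonneg hL hL) h3]

/-- The function `F⁺_{A,B}` on `V`. -/
noncomputable def Fplus (A B : ℝ → ℂ) (p : V) : ℂ :=
  if 0 < S0f p ∧ Sf p ≠ 0 then
    (A (nu1r p) * B (nu2r p) + A (nu2r p) * B (nu1r p)) / (|nu1r p - nu2r p| : ℝ)
  else 0

theorem measurable_Fplus {A B : ℝ → ℂ} (hA : Measurable A) (hB : Measurable B) :
    Measurable (Fplus A B) := by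
  have h1 := continuous_nu1r.measurable
  have h2 := continuous_nu2r.measurable
  refine Measurable.ite ?_ ?_ measurable_const
  · exact (isOpen_lt continuous_const continuous_S0f).measurableSet.inter
      (isOpen_ne_fun continuous_Sf continuous_const).measurableSet
  · exact (((hA.comp h1).mul (hB.comp h2)).add ((hA.comp h2).mul (hB.comp h1))).div
      (by fun_prop)

theorem cond_of_Fplus_ne_zero {A B : ℝ → ℂ} {p : V} (h : Fplus A B p ≠ 0) :
    0 < S0f p ∧ Sf p ≠ 0 := by
  by_contra hc
  exact h (if_neg hc)

/-- On a bounded set, `|F⁺| √S₀` is controlled by the logarithms of the eigenvalues. -/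
theorem exists_norm_Fplus_mul_sqrt_le {A B : ℝ → ℂ} (hA : HasLogGrowth A) (hB : HasLogGrowth B)
    (R : ℝ) : ∃ C M : ℝ, 0 ≤ C ∧ 0 < M ∧ ∀ p ∈ Metric.closedBall (0 : V) R,
      |nu1r p| ≤ M ∧ |nu2r p| ≤ M ∧ ‖Fplus A B p‖ * √(S0f p) ≤
        C * ((1 + |Real.log (|nu1r p|)|) * (1 + |Real.log (|nu2r p|)|)) := by
  have hK := isCompact_closedBall (0 : V) R
  obtain ⟨M₁, hM₁⟩ := hK.exists_bound_of_continuousOn continuous_nu1r.continuousOn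
  obtain ⟨M₂, hM₂⟩ := hK.exists_bound_of_continuousOn continuous_nu2r.continuousOn
  set M := max (max M₁ M₂) 1
  obtain ⟨a, ha, hAle⟩ := hA.2 M
  obtain ⟨b, hb, hBle⟩ := hB.2 M
  refine ⟨2 * (a * b), M, by positivity, by positivity, fun p hp => ?_⟩
  have h1 : |nu1r p| ≤ M := (hM₁ p hp).trans ((le_max_left _ _).trans (le_max_left _ _))
  have h2 : |nu2r p| ≤ M := (hM₂ p hp).trans ((le_max_right _ _).trans (le_max_left _ _))
  refine ⟨h1, h2, ?_⟩
  by_cases hc : 0 < S0f p ∧ Sf p ≠ 0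
  · have hpos : 0 < √(S0f p) := Real.sqrt_pos.2 hc.1
    rw [Fplus, if_pos hc, norm_div, Complex.norm_real, Real.norm_eq_abs, abs_abs, nu1r_sub_nu2r,
      abs_of_pos hpos, div_mul_cancel₀ _ hpos.ne']
    refine (norm_add_le _ _).trans ?_
    rw [norm_mul, norm_mul]
    have e1 := mul_le_mul (hAle _ h1) (hBle _ h2) (norm_nonneg _) (by positivity)
    have e2 := mul_le_mul (hAle _ h2) (hBle _ h1) (norm_nonneg _) (by positivity)
    linarith
  · rw [Fplus, if_neg hc]
    simp only [norm_zero, zero_mul]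
    positivity

theorem exists_integrableOn_Fplus_of_Sf_ne_zero {A B : ℝ → ℂ} (hA : HasLogGrowth A)
    (hB : HasLogGrowth B) {x : V} (hx : Sf x ≠ 0) :
    ∃ s ∈ nhds x, IntegrableOn (Fplus A B) s := by
  have hdet : (Matrix.of x.1).det ≠ 0 := left_ne_zero_of_mul hx
  set δ := |Sf x| / 2
  set ε := |(Matrix.of x.1).det| / 2
  set R := ‖x‖ + 1
  have hδ : 0 < δ := half_pos (abs_pos.2 hx)
  have hε : 0 < ε := half_pos (abs_pos.2 hdet)
  have hδx : δ < |Sf x| := half_lt_self (abs_pos.2 hx)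
  have hεx : ε < |(Matrix.of x.1).det| := half_lt_self (abs_pos.2 hdet)
  have hdetc : Continuous fun p : V => |(Matrix.of p.1).det| :=
    (continuous_matrixTwo_det.comp continuous_fst).abs
  set s : Set V := (Metric.ball 0 R ∩ {p | δ < |Sf p|}) ∩ {p | ε < |(Matrix.of p.1).det|}
  have hs : IsOpen s := (Metric.isOpen_ball.inter
    (isOpen_lt continuous_const continuous_Sf.abs)).inter (isOpen_lt continuous_const hdetc)
  have hxs : x ∈ s := ⟨⟨by simp [R], hδx⟩, hεx⟩
  refine ⟨s, hs.mem_nhds hxs, ?_⟩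
  obtain ⟨C, M, hC, hM, hle⟩ := exists_norm_Fplus_mul_sqrt_le hA hB R
  set L := M + (δ / M)⁻¹
  refine integrableOn_of_norm_mul_sqrt_le (t := fun p => S0f p / 4)
    (C := C * ((1 + L) * (1 + L))) (measurable_Fplus hA.1 hB.1)
    (continuous_S0f.div_const 4).measurable hs.measurableSet (fun p hp h0 => ?_) ?_
  · have hc := cond_of_Fplus_ne_zero h0
    obtain ⟨h1, h2, h3⟩ := hle p (Metric.ball_subset_closedBall hp.1.1)
    have hprod : δ < |nu1r p| * |nu2r p| := by
      rw [← abs_mul, nu1r_mul_nu2r hc.1.le]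
      exact hp.1.2
    have l1 : |Real.log (|nu1r p|)| ≤ L := by
      refine abs_log_le_of_le (by positivity) ?_ h1
      rw [div_le_iff₀ hM]
      exact hprod.le.trans (by gcongr)
    have l2 : |Real.log (|nu2r p|)| ≤ L := by
      refine abs_log_le_of_le (by positivity) ?_ h2
      rw [div_le_iff₀' hM]
      exact hprod.le.trans (by gcongr)
    have hL : 0 ≤ L := (abs_nonneg _).trans l1
    refine ⟨(div_pos hc.1 four_pos).ne', ?_⟩
    calc ‖Fplus A B p‖ * √|S0f p / 4| ≤ ‖Fplus A B p‖ * √(S0f p) := by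
          gcongr
          rw [abs_of_pos (div_pos hc.1 four_pos)]
          linarith [hc.1]
      _ ≤ _ := h3
      _ ≤ _ := by gcongr
  · refine (lintegral_mono_set fun p hp => ?_).trans_lt
      (setLIntegral_invSqrtWeight_S0f_lt_top R hε)
    have hp' : ‖p‖ ≤ R := (mem_ball_zero_iff.1 hp.1.1).le
    exact ⟨⟨(norm_fst_le p).trans hp', hp.2.le⟩,
      mem_closedBall_zero_iff.2 ((norm_snd_le p).trans hp')⟩

theorem exists_integrableOn_Fplus_of_Sf_eq_zero {A B : ℝ → ℂ} (hA : HasLogGrowth A)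
    (hB : HasLogGrowth B) {x : V} (hx : Sf x = 0) (hQ : Qf x ≠ 0) :
    ∃ s ∈ nhds x, IntegrableOn (Fplus A B) s := by
  have hS0x : 0 < S0f x := by
    rw [S0f, hx]
    simpa using sq_pos_of_ne_zero hQ
  set q := S0f x / 2
  set R := ‖x‖ + 1
  have hq : 0 < q := half_pos hS0x
  set s : Set V := Metric.ball 0 R ∩ {p | q < S0f p}
  have hs : IsOpen s := Metric.isOpen_ball.inter (isOpen_lt continuous_const continuous_S0f)
  have hxs : x ∈ s := ⟨by simp [R], half_lt_self hS0x⟩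
  refine ⟨s, hs.mem_nhds hxs, ?_⟩
  obtain ⟨C, M, hC, hM, hle⟩ := exists_norm_Fplus_mul_sqrt_le hA hB R
  set ε := √q / 2
  have hsq : 0 < √q := Real.sqrt_pos.2 hq
  have hε : 0 < ε := half_pos hsq
  refine integrableOn_of_norm_mul_sqrt_le (t := Sf)
    (C := C * ((1 + (M + ε⁻¹)) ^ 2 * (√(M * M) + 2 * (M * M) + 2)) / √q)
    (measurable_Fplus hA.1 hB.1) continuous_Sf.measurable hs.measurableSet (fun p hp h0 => ?_)
    ((lintegral_mono_set fun p hp => Metric.ball_subset_closedBall hp.1).trans_lt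
      (setLIntegral_invSqrtWeight_Sf_lt_top R))
  obtain ⟨hS0, hS⟩ := cond_of_Fplus_ne_zero h0
  obtain ⟨h1, h2, h3⟩ := hle p (Metric.ball_subset_closedBall hp.1)
  refine ⟨hS, ?_⟩
  have hprod := nu1r_mul_nu2r hS0.le
  have hn1 : nu1r p ≠ 0 := left_ne_zero_of_mul (hprod ▸ hS)
  have hn2 : nu2r p ≠ 0 := right_ne_zero_of_mul (hprod ▸ hS)
  have hqS : √q ≤ √(S0f p) := Real.sqrt_le_sqrt (le_of_lt hp.2)
  have hlog : (1 + |Real.log (|nu1r p|)|) * (1 + |Real.log (|nu2r p|)|) ≤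
      (1 + (M + ε⁻¹)) ^ 2 * (1 + |Real.log (|Sf p|)|) := by
    by_cases hlarge : ε ≤ |nu1r p|
    · rw [← hprod]
      exact one_add_abs_log_mul_le hε hlarge h1 hn2
    · have hlarge' : ε ≤ |nu2r p| := by
        have h4 := abs_sub (nu1r p) (nu2r p)
        rw [nu1r_sub_nu2r, abs_of_nonneg (Real.sqrt_nonneg _)] at h4
        have h5 : ε + ε = √q := add_halves _
        linarith
      rw [← hprod, mul_comm (nu1r p), mul_comm (1 + |Real.log (|nu1r p|)|)]
      exact one_add_abs_log_mul_le hε hlarge' h2 hn1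
  have hSM : |Sf p| ≤ M * M := by
    rw [← hprod, abs_mul]
    gcongr
  have hpos : 0 < √|Sf p| := Real.sqrt_pos.2 (abs_pos.2 hS)
  have hw := (le_div_iff₀ hpos).1 (one_add_abs_log_le hS hSM)
  rw [le_div_iff₀ hsq]
  calc ‖Fplus A B p‖ * √|Sf p| * √q ≤ ‖Fplus A B p‖ * √(S0f p) * √|Sf p| := by
        rw [mul_right_comm]
        gcongr
    _ ≤ C * ((1 + (M + ε⁻¹)) ^ 2 * (1 + |Real.log (|Sf p|)|)) * √|Sf p| :=
        mul_le_mul_of_nonneg_right (h3.trans (by gcongr)) hpos.le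
    _ = C * ((1 + (M + ε⁻¹)) ^ 2 * ((1 + |Real.log (|Sf p|)|) * √|Sf p|)) := by ring
    _ ≤ _ := by gcongr

/-- For each of the four pairs `(A,B)` with `A ∈ {Φ_{λ₁}, W^r_{λ₁}}` and
`B ∈ {Φ_{λ₂}, W^r_{λ₂}}`, the function `F⁺_{A,B}` is locally integrable on `𝒰`. -/
theorem Fplus_locallyIntegrableOn_U (l1 l2 : ℂ) (h : l1 * l2 * (l1 - l2) ≠ 0)
    (A B : ℝ → ℂ)
    (hA : A = (fun t : ℝ => Phi l1 (t : ℂ)) ∨ A = Wr l1)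
    (hB : B = (fun t : ℝ => Phi l2 (t : ℂ)) ∨ B = Wr l2) :
    LocallyIntegrableOn (fun p : V =>
      if 0 < S0f p ∧ Sf p ≠ 0 then
        (A (nu1r p) * B (nu2r p) + A (nu2r p) * B (nu1r p)) / (|nu1r p - nu2r p| : ℝ)
      else 0) U volume := by
  have hA' : HasLogGrowth A := by
    rcases hA with rfl | rfl
    exacts [hasLogGrowth_Phi l1, hasLogGrowth_Wr l1]
  have hB' : HasLogGrowth B := by
    rcases hB with rfl | rfl
    exacts [hasLogGrowth_Phi l2, hasLogGrowth_Wr l2]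
  intro x hx
  obtain ⟨s, hs, hint⟩ : ∃ s ∈ nhds x, IntegrableOn (Fplus A B) s := by
    by_cases hS : Sf x = 0
    · exact exists_integrableOn_Fplus_of_Sf_eq_zero hA' hB' hS fun hQ => hx ⟨hQ, hS⟩
    · exact exists_integrableOn_Fplus_of_Sf_ne_zero hA' hB' hS
  exact ⟨s, mem_nhdsWithin_of_mem_nhds hs, hint⟩
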